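/- Let α, β be positive reals with α + β = 1 and let c, c′ be positive reals. Then for every real y with 0 ≤ y ≤ 1/α, one has α·c·y^β + β·c′·((1 − α·y)/β)^β ≤ ( α·c^{1/α} + β·(c′)^{1/α} )^α, and the left-hand side attains this maximal value at y = ( α + β·(c′/c)^{1/α} )^{−1}. -/

import Mathlib

/-- Weighted AM-GM, homogenized: `a ^ α * y ^ β` lies below its tangent plane at `y = a / S`. -/
theorem rpow_mul_rpow_le_rpow_mul {α β a y S : ℝ} (hα : 0 < α) (hβ : 0 < β) (hαβ : α + β = 1)
    (ha : 0 ≤ a) (hy : 0 ≤ y) (hS : 0 < S) :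
    a ^ α * y ^ β ≤ S ^ α * (α * (a / S) + β * y) := by
  have h := Real.geom_mean_le_arith_mean2_weighted hα.le hβ.le (div_nonneg ha hS.le) hy hαβ
  have hSα : 0 < S ^ α := Real.rpow_pos_of_pos hS α
  calc a ^ α * y ^ β = S ^ α * ((a / S) ^ α * y ^ β) := by
        rw [Real.div_rpow ha hS.le]
        field_simp
    _ ≤ _ := by gcongr

/-- The equality case of `rpow_mul_rpow_le_rpow_mul`. -/
theorem rpow_mul_div_rpow_eq {α β a S : ℝ} (hαβ : α + β = 1) (ha : 0 < a) (hS : 0 < S) :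
    a ^ α * (a / S) ^ β = S ^ α * (a / S) := by
  have h : (a / S) ^ α * (a / S) ^ β = a / S := by
    rw [← Real.rpow_add (div_pos ha hS), hαβ, Real.rpow_one]
  rw [Real.div_rpow ha.le hS.le α] at h
  have hSα : 0 < S ^ α := Real.rpow_pos_of_pos hS α
  field_simp at h ⊢
  linarith


/-- One-variable optimization lemma used in the proof of the main theorem. -/
theorem one_variable_maximization
    (α β c c' : ℝ) (hα : 0 < α) (hβ : 0 < β) (hαβ : α + β = 1)
    (hc : 0 < c) (hc' : 0 < c') :
    (∀ y : ℝ, 0 ≤ y → y ≤ 1 / α →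
      α * c * y ^ β + β * c' * ((1 - α * y) / β) ^ β ≤
        (α * c ^ (1 / α) + β * c' ^ (1 / α)) ^ α) ∧
    (α * c * ((α + β * (c' / c) ^ (1 / α))⁻¹ : ℝ) ^ β +
        β * c' * ((1 - α * (α + β * (c' / c) ^ (1 / α))⁻¹) / β) ^ β =
      (α * c ^ (1 / α) + β * c' ^ (1 / α)) ^ α) := by
  obtain ⟨a, ha, hca⟩ : ∃ a : ℝ, 0 < a ∧ c = a ^ α :=
    ⟨c ^ (1 / α), Real.rpow_pos_of_pos hc _, by
      rw [← Real.rpow_mul hc.le, one_div_mul_cancel hα.ne', Real.rpow_one]⟩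
  obtain ⟨b, hb, hcb⟩ : ∃ b : ℝ, 0 < b ∧ c' = b ^ α :=
    ⟨c' ^ (1 / α), Real.rpow_pos_of_pos hc' _, by
      rw [← Real.rpow_mul hc'.le, one_div_mul_cancel hα.ne', Real.rpow_one]⟩
  subst hca hcb
  have root : ∀ x : ℝ, 0 ≤ x → (x ^ α) ^ (1 / α) = x := fun x hx => by
    rw [← Real.rpow_mul hx, mul_one_div_cancel hα.ne', Real.rpow_one]
  rw [← Real.div_rpow hb.le ha.le, root a ha.le, root b hb.le, root _ (div_pos hb ha).le]
  obtain ⟨S, hSdef⟩ : ∃ S : ℝ, S = α * a + β * b := ⟨_, rfl⟩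
  have hS : 0 < S := by rw [hSdef]; positivity
  have hsum : α * (a / S) + β * (b / S) = 1 := by
    field_simp
    exact hSdef.symm
  rw [← hSdef]
  constructor
  · intro y hy hy'
    obtain ⟨z, hz⟩ : ∃ z : ℝ, z = (1 - α * y) / β := ⟨_, rfl⟩
    have hyz : α * y + β * z = 1 := by
      rw [hz]
      field_simp
      ring
    have hz0 : 0 ≤ z := by
      rw [le_div_iff₀ hα] at hy'
      rw [hz]
      exact div_nonneg (by linarith) hβ.le
    rw [← hz]
    calc α * a ^ α * y ^ β + β * b ^ α * z ^ β
        = α * (a ^ α * y ^ β) + β * (b ^ α * z ^ β) := by ring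
      _ ≤ α * (S ^ α * (α * (a / S) + β * y)) + β * (S ^ α * (α * (b / S) + β * z)) := by
          exact add_le_add
            (mul_le_mul_of_nonneg_left
              (rpow_mul_rpow_le_rpow_mul hα hβ hαβ ha.le hy hS) hα.le)
            (mul_le_mul_of_nonneg_left
              (rpow_mul_rpow_le_rpow_mul hα hβ hαβ hb.le hz0 hS) hβ.le)
      _ = S ^ α * (α * (α * (a / S) + β * (b / S)) + β * (α * y + β * z)) := by ring
      _ = S ^ α := by rw [hsum, hyz, mul_one, mul_one, hαβ, mul_one]
  · have hy : (α + β * (b / a))⁻¹ = a / S := by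
      rw [hSdef]
      field_simp
    have hz : (1 - α * (a / S)) / β = b / S := by
      rw [div_eq_iff hβ.ne']
      linarith
    rw [hy, hz, mul_assoc, mul_assoc, rpow_mul_div_rpow_eq hαβ ha hS,
      rpow_mul_div_rpow_eq hαβ hb hS]
    linear_combination S ^ α * hsum
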